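/- Suppose the BFGS initialization satisfies ‖x_0 − x_*‖ ≤ (μ^{3/2}/(M√L))·ε and ‖Ĥ_0 − I‖_F ≤ δ, where ε, δ > 0 are such that for some r ∈ (0, 1) both [(2δ + 1)·4(1 + 2ε² + ε³)/(1 − ε)² + (3 + 2ε)/(1 − ε)]·ε/(1 − r) ≤ δ and (2δ + 1)ε + 2δ ≤ r. Then for every k ≥ 1 the BFGS iterates satisfy ‖x_k − x_*‖ ≤ √(L/μ)·( (2√2·δ·((1 + ε)(1 + r)/((1 − ε)(1 − r)))·√k + (1 + ε)ε(1 + r)/((1 − ε)²(1 − r)²)) / k )^k · ‖x_0 − x_*‖. -/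

import Mathlib

noncomputable section

open Matrix Finset

abbrev E (d : ℕ) := EuclideanSpace ℝ (Fin d)
abbrev Mat (d : ℕ) := Matrix (Fin d) (Fin d) ℝ

/-- Spectral (operator 2-) norm of a real matrix. -/
def spec {d : ℕ} (A : Mat d) : ℝ := ‖Matrix.toEuclideanCLM (𝕜 := ℝ) A‖

/-- Frobenius norm of a real matrix. -/
def frob {d : ℕ} (A : Mat d) : ℝ := Real.sqrt (∑ i, ∑ j, (A i j) ^ 2)

/-- A matrix acting on a Euclidean vector. -/
def mApp {d : ℕ} (A : Mat d) (v : E d) : E d := Matrix.toEuclideanCLM (𝕜 := ℝ) A v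

/-- Outer product `u vᵀ`. -/
def outer {d : ℕ} (u v : E d) : Mat d := Matrix.of fun i j => u i * v j

/-- Euclidean dot product. -/
def dot {d : ℕ} (u v : E d) : ℝ := ∑ i, u i * v i

/-- `σ(x) = (M/μ^{3/2})·‖H_*^{1/2}(x − x_*)‖`. -/
def sig {d : ℕ} (M μ : ℝ) (sqH : Mat d) (xs x : E d) : ℝ :=
  M / μ ^ ((3:ℝ)/2) * ‖mApp sqH (x - xs)‖

/-- The BFGS update of the inverse Hessian approximation. -/
def bfgsUpdate {d : ℕ} (H : Mat d) (s y : E d) : Mat d :=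
  (1 - (dot y s)⁻¹ • outer s y) * H * (1 - (dot s y)⁻¹ • outer y s)
    + (dot y s)⁻¹ • outer s s

lemma dot_eq_inner {d : ℕ} (u v : E d) : dot u v = inner ℝ u v := by
  simp [dot, PiLp.inner_apply, mul_comm]

lemma dot_comm {d : ℕ} (u v : E d) : dot u v = dot v u := by
  simp only [dot, mul_comm]

lemma dot_self {d : ℕ} (u : E d) : dot u u = ‖u‖ ^ 2 := by
  rw [dot_eq_inner, real_inner_self_eq_norm_sq]

lemma mApp_apply {d : ℕ} (A : Mat d) (v : E d) (i : Fin d) :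
    mApp A v i = ∑ j, A i j * v j := by
  simp [mApp, Matrix.mulVec, dotProduct]

lemma mApp_mul {d : ℕ} (A B : Mat d) (v : E d) : mApp (A * B) v = mApp A (mApp B v) := by
  simp [mApp]

lemma mApp_one {d : ℕ} (v : E d) : mApp 1 v = v := by
  simp [mApp]

lemma mApp_sub_left {d : ℕ} (A B : Mat d) (v : E d) :
    mApp (A - B) v = mApp A v - mApp B v := by
  simp [mApp]

lemma mApp_sub {d : ℕ} (A : Mat d) (u v : E d) : mApp A (u - v) = mApp A u - mApp A v := by
  simp [mApp]

lemma dot_mApp {d : ℕ} (A : Mat d) (u v : E d) : dot u (mApp A v) = dot (mApp Aᵀ u) v := by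
  simp only [dot, mApp_apply, Matrix.transpose_apply, Finset.mul_sum, Finset.sum_mul]
  rw [Finset.sum_comm]
  refine Finset.sum_congr rfl fun i _ => Finset.sum_congr rfl fun j _ => by ring

lemma mul_outer {d : ℕ} (A : Mat d) (u v : E d) : A * outer u v = outer (mApp A u) v := by
  ext i j
  simp only [Matrix.mul_apply, outer, Matrix.of_apply, mApp_apply, Finset.sum_mul, mul_assoc]

lemma outer_mul {d : ℕ} (A : Mat d) (u v : E d) : outer u v * A = outer u (mApp Aᵀ v) := by
  ext i j
  simp only [Matrix.mul_apply, outer, Matrix.of_apply, mApp_apply, Finset.mul_sum,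
    Matrix.transpose_apply]
  refine Finset.sum_congr rfl fun i _ => by ring

lemma outer_mul_outer {d : ℕ} (u v w z : E d) :
    outer u v * outer w z = dot v w • outer u z := by
  ext i j
  simp only [Matrix.mul_apply, outer, Matrix.of_apply, dot, Matrix.smul_apply, smul_eq_mul,
    Finset.sum_mul]
  refine Finset.sum_congr rfl fun i _ => by ring

lemma transpose_outer {d : ℕ} (u v : E d) : (outer u v)ᵀ = outer v u := by
  ext i j
  simp [outer, mul_comm]

lemma frob_nonneg {d : ℕ} (A : Mat d) : 0 ≤ frob A := Real.sqrt_nonneg _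

lemma frob_sq {d : ℕ} (A : Mat d) : frob A ^ 2 = ∑ i, ∑ j, (A i j) ^ 2 :=
  Real.sq_sqrt (by positivity)

open scoped Matrix.Norms.Frobenius in
lemma frob_eq_norm {d : ℕ} (A : Mat d) : frob A = ‖A‖ := by
  rw [Matrix.frobenius_norm_def, frob, Real.sqrt_eq_rpow]
  simp

open scoped Matrix.Norms.Frobenius in
lemma frob_add_le {d : ℕ} (A B : Mat d) : frob (A + B) ≤ frob A + frob B := by
  simpa only [frob_eq_norm] using norm_add_le A B

open scoped Matrix.Norms.Frobenius in
lemma frob_sub_le {d : ℕ} (A B : Mat d) : frob (A - B) ≤ frob A + frob B := by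
  simpa only [frob_eq_norm] using norm_sub_le A B

open scoped Matrix.Norms.Frobenius in
lemma frob_smul {d : ℕ} (c : ℝ) (A : Mat d) : frob (c • A) = |c| * frob A := by
  simpa only [frob_eq_norm, Real.norm_eq_abs] using norm_smul c A

lemma frob_transpose {d : ℕ} (A : Mat d) : frob Aᵀ = frob A := by
  rw [frob, frob, Finset.sum_comm]
  rfl

lemma frob_outer {d : ℕ} (u v : E d) : frob (outer u v) = ‖u‖ * ‖v‖ := by
  rw [← abs_of_nonneg (frob_nonneg _), ← abs_of_nonneg (by positivity : 0 ≤ ‖u‖ * ‖v‖),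
    ← sq_eq_sq_iff_abs_eq_abs, frob_sq, mul_pow, EuclideanSpace.real_norm_sq_eq,
    EuclideanSpace.real_norm_sq_eq, Finset.sum_mul_sum]
  simp only [outer, Matrix.of_apply, mul_pow]

lemma norm_mApp_le {d : ℕ} (A : Mat d) (v : E d) : ‖mApp A v‖ ≤ frob A * ‖v‖ := by
  refine le_of_sq_le_sq ?_ (mul_nonneg (frob_nonneg _) (norm_nonneg _))
  rw [mul_pow, frob_sq, EuclideanSpace.real_norm_sq_eq, EuclideanSpace.real_norm_sq_eq,
    Finset.sum_mul]
  refine Finset.sum_le_sum fun i _ => ?_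
  rw [mApp_apply]
  exact Finset.sum_mul_sq_le_sq_mul_sq _ _ _

lemma frob_mul_proj_sq {d : ℕ} (D : Mat d) {y : E d} (hy : y ≠ 0) :
    frob (D * (1 - (‖y‖ ^ 2)⁻¹ • outer y y)) ^ 2
      = frob D ^ 2 - (‖mApp D y‖ / ‖y‖) ^ 2 := by
  have hy2 : ‖y‖ ^ 2 ≠ 0 := by simpa using hy
  set t := (‖y‖ ^ 2)⁻¹ with ht
  have hyn : ∑ j, y j ^ 2 = ‖y‖ ^ 2 := (EuclideanSpace.real_norm_sq_eq y).symm
  rw [mul_sub, mul_one, Matrix.mul_smul, mul_outer, frob_sq, frob_sq, div_pow,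
    EuclideanSpace.real_norm_sq_eq (mApp D y), Finset.sum_div, ← Finset.sum_sub_distrib]
  refine Finset.sum_congr rfl fun i _ => ?_
  have h1 : ∀ j, (D - t • outer (mApp D y) y) i j ^ 2
      = D i j ^ 2 - 2 * t * mApp D y i * (D i j * y j) + (t * mApp D y i) ^ 2 * y j ^ 2 := by
    intro j
    simp only [Matrix.sub_apply, Matrix.smul_apply, outer, Matrix.of_apply, smul_eq_mul]
    ring
  simp only [h1]
  rw [Finset.sum_add_distrib, Finset.sum_sub_distrib, ← Finset.mul_sum, ← Finset.mul_sum,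
    ← mApp_apply, hyn, ht]
  field_simp
  ring

lemma frob_mul_proj_le {d : ℕ} (D : Mat d) {y : E d} (hy : y ≠ 0) :
    frob (D * (1 - (‖y‖ ^ 2)⁻¹ • outer y y)) ≤ frob D := by
  refine le_of_sq_le_sq ?_ (frob_nonneg _)
  rw [frob_mul_proj_sq D hy]
  nlinarith [sq_nonneg (‖mApp D y‖ / ‖y‖)]

lemma frob_proj_mul_le {d : ℕ} (D : Mat d) {y : E d} (hy : y ≠ 0) :
    frob ((1 - (‖y‖ ^ 2)⁻¹ • outer y y) * D) ≤ frob D := by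
  have h := frob_mul_proj_le Dᵀ hy
  rw [frob_transpose] at h
  rw [← frob_transpose]
  simpa [Matrix.transpose_mul, transpose_outer] using h

/-- Removing the component of `D` along `y` decreases its Frobenius norm. -/
lemma frob_proj_mul_proj_le {d : ℕ} (D : Mat d) {y : E d} (hy : y ≠ 0) {a : ℝ} (ha : 0 < a)
    (hD : frob D ≤ a) :
    frob ((1 - (‖y‖ ^ 2)⁻¹ • outer y y) * (D * (1 - (‖y‖ ^ 2)⁻¹ • outer y y)))
      ≤ frob D - (‖mApp D y‖ / ‖y‖) ^ 2 / (2 * a) := by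
  have hθ : ‖mApp D y‖ / ‖y‖ ≤ frob D := by
    rw [div_le_iff₀ (norm_pos_iff.2 hy)]
    exact norm_mApp_le D y
  have hθ0 : 0 ≤ ‖mApp D y‖ / ‖y‖ := by positivity
  have h := frob_mul_proj_sq D hy
  set θ := ‖mApp D y‖ / ‖y‖
  have hD0 := frob_nonneg D
  refine (frob_proj_mul_le _ hy).trans (le_of_sq_le_sq ?_ ?_)
  · rw [h]
    have : 2 * frob D * (θ ^ 2 / (2 * a)) ≤ θ ^ 2 := by
      rw [mul_div_assoc', div_le_iff₀ (by positivity)]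
      nlinarith [sq_nonneg θ]
    nlinarith [sq_nonneg (θ ^ 2 / (2 * a))]
  · rw [sub_nonneg, div_le_iff₀ (by positivity)]
    nlinarith

lemma frob_smul_outer_sub_sq {d : ℕ} (a b : ℝ) (s y : E d) :
    frob (a • outer s s - b • outer y y) ^ 2
      = (a * ‖s‖ ^ 2) ^ 2 - 2 * a * b * dot y s ^ 2 + (b * ‖y‖ ^ 2) ^ 2 := by
  have h1 : ∀ i j, (a • outer s s - b • outer y y) i j ^ 2
      = a ^ 2 * (s i ^ 2 * s j ^ 2) - 2 * a * b * (y i * s i * (y j * s j))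
        + b ^ 2 * (y i ^ 2 * y j ^ 2) := by
    intro i j
    simp only [Matrix.sub_apply, Matrix.smul_apply, outer, Matrix.of_apply, smul_eq_mul]
    ring
  rw [frob_sq]
  simp only [h1, Finset.sum_add_distrib, Finset.sum_sub_distrib, ← Finset.mul_sum,
    ← Finset.sum_mul, ← EuclideanSpace.real_norm_sq_eq]
  rw [show ∑ i, y i * s i = dot y s from rfl]
  ring

lemma norm_mApp_le_of_frob_sub_one {d : ℕ} {A : Mat d} {a : ℝ} (hA : frob (A - 1) ≤ a) (v : E d) :
    ‖mApp A v‖ ≤ (1 + a) * ‖v‖ := by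
  have h1 : mApp A v = v + mApp (A - 1) v := by
    rw [mApp_sub_left, mApp_one]; abel
  have h2 := norm_mApp_le (A - 1) v
  have h3 := norm_add_le v (mApp (A - 1) v)
  rw [h1]
  nlinarith [norm_nonneg v]

lemma le_norm_mApp_of_frob_sub_one {d : ℕ} {A : Mat d} {a : ℝ} (hA : frob (A - 1) ≤ a) (v : E d) :
    (1 - a) * ‖v‖ ≤ ‖mApp A v‖ := by
  have h1 : v = mApp A v - mApp (A - 1) v := by
    rw [mApp_sub_left, mApp_one]; abel
  have h2 := norm_mApp_le (A - 1) v
  have h3 := norm_sub_le (mApp A v) (mApp (A - 1) v)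
  rw [← h1] at h3
  nlinarith [norm_nonneg v]

lemma bfgsUpdate_sub_one {d : ℕ} (A : Mat d) (s : E d) {y : E d} (hy : y ≠ 0) :
    bfgsUpdate A s y - 1
      = (1 - (‖y‖ ^ 2)⁻¹ • outer y y) * ((A - 1) * (1 - (‖y‖ ^ 2)⁻¹ • outer y y))
        - outer ((dot y s)⁻¹ • s - (‖y‖ ^ 2)⁻¹ • y) (mApp Aᵀ y) * (1 - (‖y‖ ^ 2)⁻¹ • outer y y)
        - (1 - (‖y‖ ^ 2)⁻¹ • outer y y) * outer (mApp A y) ((dot y s)⁻¹ • s - (‖y‖ ^ 2)⁻¹ • y)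
        + dot y (mApp A y) • outer ((dot y s)⁻¹ • s - (‖y‖ ^ 2)⁻¹ • y)
            ((dot y s)⁻¹ • s - (‖y‖ ^ 2)⁻¹ • y)
        + ((dot y s)⁻¹ • outer s s - (‖y‖ ^ 2)⁻¹ • outer y y) := by
  have hy2 : ‖y‖ ^ 2 ≠ 0 := by simpa using hy
  rw [bfgsUpdate, dot_comm s y]
  set ρ := dot y s
  set w := ρ⁻¹ • s - (‖y‖ ^ 2)⁻¹ • y with hw
  have hQ : (1 : Mat d) - ρ⁻¹ • outer s y = 1 - (‖y‖ ^ 2)⁻¹ • outer y y - outer w y := by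
    ext i j
    simp [outer, hw]
    ring
  have hQ' : (1 : Mat d) - ρ⁻¹ • outer y s = 1 - (‖y‖ ^ 2)⁻¹ • outer y y - outer y w := by
    ext i j
    simp [outer, hw]
    ring
  have hUU : ((‖y‖ ^ 2)⁻¹ • outer y y) * ((‖y‖ ^ 2)⁻¹ • outer y y) = (‖y‖ ^ 2)⁻¹ • outer y y := by
    rw [Matrix.smul_mul, Matrix.mul_smul, outer_mul_outer, dot_self, smul_smul (‖y‖ ^ 2)⁻¹ (‖y‖ ^ 2),
      inv_mul_cancel₀ hy2, one_smul]
  rw [hQ, hQ', ← outer_mul, ← mul_outer, ← outer_mul_outer, ← mul_outer]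
  generalize (‖y‖ ^ 2)⁻¹ • outer y y = U at *
  generalize outer w y = W
  generalize outer y w = W'
  have hPP : (1 - U) * (1 - U) = 1 - U := by
    rw [sub_mul, mul_sub, mul_sub, hUU]; simp
  have h1 : (1 - U) * ((A - 1) * (1 - U)) = (1 - U) * A * (1 - U) - (1 - U) := by
    rw [sub_mul A, one_mul, mul_sub (1 - U), hPP, mul_assoc]
  rw [h1]
  generalize hP : 1 - U = P
  rw [show U = 1 - P by rw [← hP]; abel]
  noncomm_ring

lemma norm_pos_of_norm_sub_le {d : ℕ} {s y : E d} {τ : ℝ} (hs : s ≠ 0)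
    (hτ1 : τ < 1) (hys : ‖y - s‖ ≤ τ * ‖s‖) : 0 < ‖y‖ := by
  have hS : 0 < ‖s‖ := norm_pos_iff.2 hs
  have := norm_sub_norm_le s (s - y)
  rw [sub_sub_cancel, norm_sub_rev s y] at this
  nlinarith

lemma norm_le_of_norm_sub_le {d : ℕ} {s y : E d} {τ : ℝ} (hys : ‖y - s‖ ≤ τ * ‖s‖) :
    ‖y‖ ≤ (1 + τ) * ‖s‖ := by
  have := norm_add_le (y - s) s
  rw [sub_add_cancel] at this
  linarith

lemma abs_dot_sub_sq_le {d : ℕ} {s y : E d} {τ : ℝ} (hys : ‖y - s‖ ≤ τ * ‖s‖) :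
    |dot y s - ‖s‖ ^ 2| ≤ τ * ‖s‖ ^ 2 := by
  have h1 := abs_real_inner_le_norm (y - s) s
  rw [inner_sub_left, ← dot_eq_inner, ← dot_eq_inner, dot_self] at h1
  nlinarith [norm_nonneg s]

lemma sq_mul_sq_sub_dot_sq_le {d : ℕ} {s y : E d} {τ : ℝ} (hys : ‖y - s‖ ≤ τ * ‖s‖) :
    ‖s‖ ^ 2 * ‖y‖ ^ 2 - dot y s ^ 2 ≤ τ ^ 2 * ‖s‖ ^ 2 * ‖y‖ ^ 2 := by
  have h1 := norm_sub_sq_real y s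
  rw [← dot_eq_inner] at h1
  have h2 : ‖y - s‖ ^ 2 ≤ (τ * ‖s‖) ^ 2 := by gcongr
  nlinarith [sq_nonneg (‖y‖ ^ 2 - dot y s), mul_le_mul_of_nonneg_left h2 (sq_nonneg ‖y‖)]

lemma norm_secant_error_le {d : ℕ} {s y : E d} {τ : ℝ} (hs : s ≠ 0)
    (hτ : 0 ≤ τ) (hτ1 : τ < 1) (hys : ‖y - s‖ ≤ τ * ‖s‖) :
    ‖(dot y s)⁻¹ • s - (‖y‖ ^ 2)⁻¹ • y‖ * ‖y‖ ≤ τ * (1 + τ) / (1 - τ) := by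
  have hS : 0 < ‖s‖ := norm_pos_iff.2 hs
  have hY := norm_pos_of_norm_sub_le hs hτ1 hys
  have hYu := norm_le_of_norm_sub_le hys
  have hsin := sq_mul_sq_sub_dot_sq_le hys
  have hρ := abs_dot_sub_sq_le hys
  replace hτ1 : 0 < 1 - τ := by linarith
  have hw2 : ‖(dot y s)⁻¹ • s - (‖y‖ ^ 2)⁻¹ • y‖ ^ 2
      = ((dot y s)⁻¹ * ‖s‖) ^ 2 - 2 * ((dot y s)⁻¹ * (‖y‖ ^ 2)⁻¹ * dot y s)
        + ((‖y‖ ^ 2)⁻¹ * ‖y‖) ^ 2 := by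
    rw [norm_sub_sq_real, norm_smul, norm_smul, inner_smul_left, inner_smul_right,
      ← dot_eq_inner, dot_comm s y, mul_pow, mul_pow, Real.norm_eq_abs, Real.norm_eq_abs, sq_abs,
      sq_abs]
    simp only [conj_trivial]
    ring
  set ρ := dot y s
  set w := ρ⁻¹ • s - (‖y‖ ^ 2)⁻¹ • y
  have hρl : (1 - τ) * ‖s‖ ^ 2 ≤ ρ := by have := (abs_le.1 hρ).1; linarith
  have hρ0 : 0 < ρ := lt_of_lt_of_le (by positivity) hρl
  have h1 : ‖w‖ * ‖y‖ ≤ τ * ‖s‖ * ‖y‖ / ρ := by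
    refine le_of_sq_le_sq ?_ (by positivity)
    have h2 : (‖w‖ * ‖y‖) ^ 2 = (‖s‖ ^ 2 * ‖y‖ ^ 2 - ρ ^ 2) / ρ ^ 2 := by
      rw [mul_pow, hw2]; field_simp; ring
    rw [h2, div_pow]
    gcongr
    linarith
  refine h1.trans ?_
  rw [div_le_div_iff₀ hρ0 hτ1]
  have h3 : τ * ‖s‖ * ‖y‖ * (1 - τ) ≤ τ * ‖s‖ * ((1 + τ) * ‖s‖) * (1 - τ) := by gcongr
  have h4 : τ * (1 + τ) * ((1 - τ) * ‖s‖ ^ 2) ≤ τ * (1 + τ) * ρ := by gcongr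
  nlinarith

lemma frob_outer_secant_error_le {d : ℕ} {s y : E d} {τ : ℝ} (hs : s ≠ 0)
    (hτ : 0 ≤ τ) (hτ1 : τ < 1) (hys : ‖y - s‖ ≤ τ * ‖s‖) :
    frob ((dot y s)⁻¹ • outer s s - (‖y‖ ^ 2)⁻¹ • outer y y) ≤ 3 * τ / (1 - τ) := by
  have hS : 0 < ‖s‖ := norm_pos_iff.2 hs
  have hY := norm_pos_of_norm_sub_le hs hτ1 hys
  have hsin := sq_mul_sq_sub_dot_sq_le hys
  have hρ := abs_dot_sub_sq_le hys
  have hE4 := frob_smul_outer_sub_sq (dot y s)⁻¹ (‖y‖ ^ 2)⁻¹ s y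
  replace hτ1 : 0 < 1 - τ := by linarith
  set ρ := dot y s
  have hρl : (1 - τ) * ‖s‖ ^ 2 ≤ ρ := by have := (abs_le.1 hρ).1; linarith
  have hρ0 : 0 < ρ := lt_of_lt_of_le (by positivity) hρl
  have hSρ : ‖s‖ ^ 2 / ρ ≤ 1 / (1 - τ) := by
    rw [div_le_div_iff₀ hρ0 hτ1]; linarith
  refine le_of_sq_le_sq ?_ (by positivity)
  rw [hE4]
  have e1 : (ρ⁻¹ * ‖s‖ ^ 2) ^ 2 - 2 * ρ⁻¹ * (‖y‖ ^ 2)⁻¹ * ρ ^ 2 + ((‖y‖ ^ 2)⁻¹ * ‖y‖ ^ 2) ^ 2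
      = ((‖s‖ ^ 2 - ρ) / ρ) ^ 2 + 2 * ((‖s‖ ^ 2 * ‖y‖ ^ 2 - ρ ^ 2) / (ρ * ‖y‖ ^ 2)) := by
    field_simp; ring
  have e2 : ((‖s‖ ^ 2 - ρ) / ρ) ^ 2 ≤ (τ * (1 / (1 - τ))) ^ 2 := by
    refine sq_le_sq' ?_ ?_
    · have : -(τ * (‖s‖ ^ 2 / ρ)) ≤ (‖s‖ ^ 2 - ρ) / ρ := by
        rw [← mul_div_assoc, ← neg_div]
        gcongr
        linarith [(abs_le.1 hρ).2]
      nlinarith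
    · have : (‖s‖ ^ 2 - ρ) / ρ ≤ τ * (‖s‖ ^ 2 / ρ) := by
        rw [← mul_div_assoc]
        gcongr
        linarith [(abs_le.1 hρ).1]
      nlinarith
  have e3 : (‖s‖ ^ 2 * ‖y‖ ^ 2 - ρ ^ 2) / (ρ * ‖y‖ ^ 2) ≤ τ ^ 2 * (1 / (1 - τ)) := by
    have : (‖s‖ ^ 2 * ‖y‖ ^ 2 - ρ ^ 2) / (ρ * ‖y‖ ^ 2) ≤ τ ^ 2 * (‖s‖ ^ 2 / ρ) := by
      rw [div_le_iff₀ (by positivity)]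
      refine hsin.trans_eq ?_
      field_simp
    exact this.trans (by gcongr)
  have e4 : 1 ≤ 1 / (1 - τ) := by rw [le_div_iff₀ hτ1]; linarith
  rw [e1, mul_div_assoc, show τ / (1 - τ) = τ * (1 / (1 - τ)) by ring]
  set B := 1 / (1 - τ)
  have e5 : τ ^ 2 * B ≤ τ ^ 2 * B ^ 2 := by gcongr; nlinarith
  nlinarith [mul_nonneg (sq_nonneg τ) (sq_nonneg B)]

/-- One BFGS step decreases the distance of the approximation to the identity, up to an error
controlled by the relative distance between `s` and `y`. -/
lemma frob_bfgsUpdate_sub_one_le {d : ℕ} {A : Mat d} {s y : E d} {a τ ε : ℝ} (hs : s ≠ 0)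
    (hτ : 0 ≤ τ) (hτε : τ ≤ ε) (hε1 : ε < 1) (hys : ‖y - s‖ ≤ τ * ‖s‖) (ha : 0 < a)
    (hA : frob (A - 1) ≤ a) :
    frob (bfgsUpdate A s y - 1) ≤ frob (A - 1) - (‖mApp (A - 1) y‖ / ‖y‖) ^ 2 / (2 * a)
      + ((a + 1) * (4 * (1 + 2 * ε ^ 2 + ε ^ 3) / (1 - ε) ^ 2) + (3 + 2 * ε) / (1 - ε)) * τ := by
  have hτ1 : τ < 1 := by linarith
  have hy : y ≠ 0 := norm_pos_iff.1 (norm_pos_of_norm_sub_le hs hτ1 hys)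
  have hω := norm_secant_error_le hs hτ hτ1 hys
  have hF4 := frob_outer_secant_error_le hs hτ hτ1 hys
  replace hτ1 : 0 < 1 - τ := by linarith
  have hε0 : 0 ≤ ε := hτ.trans hτε
  have hAy := norm_mApp_le_of_frob_sub_one hA y
  have hAty : ‖mApp Aᵀ y‖ ≤ (1 + a) * ‖y‖ := by
    refine norm_mApp_le_of_frob_sub_one ?_ y
    rwa [← frob_transpose, Matrix.transpose_sub, Matrix.transpose_transpose, Matrix.transpose_one]
  have hyAy : |dot y (mApp A y)| ≤ (1 + a) * ‖y‖ ^ 2 := by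
    have := abs_real_inner_le_norm y (mApp A y)
    rw [← dot_eq_inner] at this
    nlinarith [norm_nonneg y]
  have hmain := frob_proj_mul_proj_le (A - 1) hy ha hA
  rw [bfgsUpdate_sub_one A s hy]
  set ρ := dot y s
  set w := ρ⁻¹ • s - (‖y‖ ^ 2)⁻¹ • y
  set P := (1 : Mat d) - (‖y‖ ^ 2)⁻¹ • outer y y
  have hF1 : frob (outer w (mApp Aᵀ y) * P) ≤ (1 + a) * (‖w‖ * ‖y‖) := by
    refine (frob_mul_proj_le _ hy).trans ?_
    rw [frob_outer]
    nlinarith [norm_nonneg w]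
  have hF2 : frob (P * outer (mApp A y) w) ≤ (1 + a) * (‖w‖ * ‖y‖) := by
    refine (frob_proj_mul_le _ hy).trans ?_
    rw [frob_outer]
    nlinarith [norm_nonneg w]
  have hF3 : frob (dot y (mApp A y) • outer w w) ≤ (1 + a) * (‖w‖ * ‖y‖) ^ 2 := by
    rw [frob_smul, frob_outer]
    nlinarith [mul_nonneg (norm_nonneg w) (norm_nonneg w)]
  have hsum : frob (P * ((A - 1) * P) - outer w (mApp Aᵀ y) * P - P * outer (mApp A y) w
        + dot y (mApp A y) • outer w w + (ρ⁻¹ • outer s s - (‖y‖ ^ 2)⁻¹ • outer y y))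
      ≤ frob (P * ((A - 1) * P)) + frob (outer w (mApp Aᵀ y) * P) + frob (P * outer (mApp A y) w)
        + frob (dot y (mApp A y) • outer w w)
        + frob (ρ⁻¹ • outer s s - (‖y‖ ^ 2)⁻¹ • outer y y) := by
    refine (frob_add_le _ _).trans ?_
    gcongr
    refine (frob_add_le _ _).trans ?_
    gcongr
    refine (frob_sub_le _ _).trans ?_
    gcongr
    exact frob_sub_le _ _
  have hω2 : (‖w‖ * ‖y‖) ^ 2 ≤ (τ * (1 + τ) / (1 - τ)) ^ 2 := by gcongr
  have hlin : 2 * (‖w‖ * ‖y‖) + (‖w‖ * ‖y‖) ^ 2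
      ≤ 4 * (1 + 2 * ε ^ 2 + ε ^ 3) / (1 - ε) ^ 2 * τ := by
    have h1 : 2 * (τ * (1 + τ) / (1 - τ)) + (τ * (1 + τ) / (1 - τ)) ^ 2
        = (2 + τ + τ ^ 3) / (1 - τ) ^ 2 * τ := by field_simp; ring
    have h2 : (2 + τ + τ ^ 3) / (1 - τ) ^ 2 ≤ 4 * (1 + 2 * ε ^ 2 + ε ^ 3) / (1 - ε) ^ 2 := by
      have h3 : τ ^ 3 ≤ ε ^ 3 := by gcongr
      have h4 : 0 < 1 - ε := by linarith
      have h5 : 0 ≤ ε ^ 3 := by positivity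
      gcongr
      nlinarith
    nlinarith [mul_le_mul_of_nonneg_right h2 hτ]
  have hlast : 3 * τ / (1 - τ) ≤ (3 + 2 * ε) / (1 - ε) * τ := by
    rw [mul_div_right_comm]
    have h4 : 0 < 1 - ε := by linarith
    gcongr
    linarith
  nlinarith [mul_le_mul_of_nonneg_left hlin (by positivity : 0 ≤ 1 + a)]

lemma prod_range_le_pow (b : ℕ → ℝ) (hb : ∀ i, 0 ≤ b i) {k : ℕ} (hk : 1 ≤ k) :
    ∏ i ∈ Finset.range k, b i ≤ ((∑ i ∈ Finset.range k, b i) / k) ^ k := by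
  have hk0 : k ≠ 0 := by omega
  have h := Real.geom_mean_le_arith_mean (Finset.range k) (fun _ => 1) b (by simp)
    (by simpa using Nat.pos_of_ne_zero hk0) (fun i _ => hb i)
  simp only [Real.rpow_one, Finset.sum_const, Finset.card_range, nsmul_eq_mul, mul_one,
    one_mul] at h
  have hp : 0 ≤ ∏ i ∈ Finset.range k, b i := Finset.prod_nonneg fun i _ => hb i
  have h2 := pow_le_pow_left₀ (Real.rpow_nonneg hp _) h k
  rwa [Real.rpow_inv_natCast_pow hp hk0] at h2

lemma sum_geometric_le {ε r : ℝ} (hε : 0 ≤ ε) (hr0 : 0 ≤ r) (hr1 : r < 1) (k : ℕ) :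
    ∑ i ∈ Finset.range k, ε * r ^ i ≤ ε / (1 - r) := by
  rw [← Finset.mul_sum, div_eq_mul_inv]
  gcongr
  rw [← tsum_geometric_of_lt_one hr0 hr1]
  exact (summable_geometric_of_lt_one hr0 hr1).sum_le_tsum _ fun i _ => by positivity

lemma le_pow_of_step_le (n θ : ℕ → ℝ) (hn : ∀ k, 0 ≤ n k) (hθ0 : ∀ k, 0 ≤ θ k) {ε δ r : ℝ}
    (hε : 0 ≤ ε) (hε1 : ε < 1) (hδ : 0 ≤ δ) (hr0 : 0 ≤ r) (hr1 : r < 1) {k : ℕ}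
    (hθsq : ∑ i ∈ Finset.range k, θ i ^ 2 ≤ 8 * δ ^ 2)
    (hstep : ∀ k, n (k + 1)
      ≤ (1 + ε) * (1 + r) / ((1 - ε) * (1 - r)) * (θ k + ε * r ^ k / (1 - ε)) * n k)
    (hk : 1 ≤ k) :
    n k ≤ ((2 * √2 * δ * ((1 + ε) * (1 + r) / ((1 - ε) * (1 - r))) * √(k : ℝ)
            + (1 + ε) * ε * (1 + r) / ((1 - ε)^2 * (1 - r)^2)) / (k : ℝ)) ^ k * n 0 := by
  have h1ε : 0 < 1 - ε := by linarith
  have h1r : 0 < 1 - r := by linarith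
  have hθsum : ∑ i ∈ Finset.range k, θ i ≤ 2 * √2 * δ * √k := by
    have h4 := sq_sum_le_card_mul_sum_sq (s := Finset.range k) (f := θ)
    rw [Finset.card_range] at h4
    refine le_of_sq_le_sq ?_ (by positivity)
    rw [mul_pow, mul_pow, mul_pow, Real.sq_sqrt (by positivity), Real.sq_sqrt (by positivity)]
    nlinarith [mul_le_mul_of_nonneg_left hθsq (Nat.cast_nonneg k : (0 : ℝ) ≤ k)]
  set C := (1 + ε) * (1 + r) / ((1 - ε) * (1 - r)) with hC
  have hC0 : 0 ≤ C := by positivity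
  set b : ℕ → ℝ := fun i => C * (θ i + ε * r ^ i / (1 - ε)) with hb
  have hb0 : ∀ i, 0 ≤ b i := fun i => by
    have := hθ0 i
    positivity
  have hprod : ∀ k, n k ≤ (∏ i ∈ Finset.range k, b i) * n 0 := by
    intro k
    induction k with
    | zero => simp
    | succ k ih =>
      have h1 := mul_le_mul_of_nonneg_left ih (hb0 k)
      rw [Finset.prod_range_succ, mul_comm (∏ i ∈ Finset.range k, b i), mul_assoc]
      exact (hstep k).trans h1
  refine (hprod k).trans (mul_le_mul_of_nonneg_right ?_ (hn 0))
  refine (prod_range_le_pow b hb0 hk).trans ?_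
  have hsum0 : 0 ≤ ∑ i ∈ Finset.range k, b i := Finset.sum_nonneg fun i _ => hb0 i
  gcongr
  rw [hb, ← Finset.mul_sum, Finset.sum_add_distrib, ← Finset.sum_div]
  calc C * (∑ i ∈ Finset.range k, θ i + (∑ i ∈ Finset.range k, ε * r ^ i) / (1 - ε))
      ≤ C * (2 * √2 * δ * √k + ε / (1 - r) / (1 - ε)) := by
        gcongr
        exact sum_geometric_le hε hr0 hr1 k
    _ = _ := by
        rw [hC]
        field_simp

/-- The contraction factor of a BFGS step is controlled by the error of the approximation in the
direction `y`. -/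
lemma norm_le_of_bfgs_step {d : ℕ} {z z' g g' : E d} {A : Mat d} {τ ε r : ℝ}
    (hz : z' = z - mApp A g) (hs : z' - z ≠ 0) (hτ0 : 0 ≤ τ) (hτε : τ ≤ ε) (hε1 : ε < 1)
    (_hr0 : 0 < r) (hr1 : r < 1) (hys : ‖g' - g - (z' - z)‖ ≤ τ * ‖z' - z‖)
    (hA : frob (A - 1) ≤ r) (hlin : ‖z'‖ ≤ r * ‖z‖) (hg : ‖g' - z'‖ ≤ ε * ‖z'‖) :
    ‖z'‖ ≤ (1 + ε) * (1 + r) / ((1 - ε) * (1 - r))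
      * (‖mApp (A - 1) (g' - g)‖ / ‖g' - g‖ + τ / (1 - ε)) * ‖z‖ := by
  have hε0 : 0 ≤ ε := hτ0.trans hτε
  have h1ε : 0 < 1 - ε := by linarith
  have h1r : 0 < 1 - r := by linarith
  have hy0 : 0 < ‖g' - g‖ := norm_pos_of_norm_sub_le hs (by linarith) hys
  have e1 : mApp A g' = mApp (A - 1) (g' - g) + (g' - g - (z' - z)) := by
    simp only [mApp_sub_left, mApp_one, mApp_sub, hz]
    abel
  have e2 := le_norm_mApp_of_frob_sub_one hA g'
  have e3 := norm_add_le (mApp (A - 1) (g' - g)) (g' - g - (z' - z))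
  rw [← e1] at e3
  have e4 : ‖mApp (A - 1) (g' - g)‖ = ‖mApp (A - 1) (g' - g)‖ / ‖g' - g‖ * ‖g' - g‖ := by
    field_simp
  have e8 : ‖g' - g‖ ≤ (1 + ε) * ((1 + r) * ‖z‖) := by
    refine (norm_le_of_norm_sub_le hys).trans ?_
    gcongr
    linarith [norm_sub_le z' z]
  have e9 : (1 - ε) * ‖z'‖ ≤ ‖g'‖ := by
    have h3 := norm_sub_norm_le z' (z' - g')
    rw [sub_sub_cancel, norm_sub_rev] at h3
    linarith
  set y := g' - g
  set s := z' - z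
  have e5 : ‖s‖ ≤ ‖y‖ / (1 - ε) := by
    rw [le_div_iff₀ h1ε]
    have := norm_sub_norm_le s (s - y)
    rw [sub_sub_cancel, norm_sub_rev s y] at this
    nlinarith [norm_nonneg s]
  have e6 : ‖y - s‖ ≤ τ / (1 - ε) * ‖y‖ := by
    refine hys.trans ?_
    rw [div_mul_eq_mul_div, mul_div_assoc]
    gcongr
  set θ := ‖mApp (A - 1) y‖ / ‖y‖
  have hb0 : 0 ≤ θ + τ / (1 - ε) := by positivity
  have e10 : (1 - r) * ((1 - ε) * ‖z'‖)
      ≤ (θ + τ / (1 - ε)) * ((1 + ε) * ((1 + r) * ‖z‖)) := by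
    calc (1 - r) * ((1 - ε) * ‖z'‖) ≤ (1 - r) * ‖g'‖ := by gcongr
      _ ≤ (θ + τ / (1 - ε)) * ‖y‖ := by linarith
      _ ≤ _ := by gcongr
  rw [div_mul_eq_mul_div, div_mul_eq_mul_div, le_div_iff₀ (by positivity)]
  linarith

/-- The scaled form of the convergence theorem, in coordinates where the Hessian at the
minimizer is the identity and the minimizer is the origin. -/
theorem bfgs_scaled {d : ℕ} (G : E d → E d) (z : ℕ → E d) (A : ℕ → Mat d) (c : ℝ)
    (hG0 : G 0 = 0)
    (hG : ∀ τ u v, c * ‖u‖ ≤ τ → c * ‖v‖ ≤ τ → ‖G u - G v - (u - v)‖ ≤ τ * ‖u - v‖)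
    (hz : ∀ k, z (k + 1) = z k - mApp (A k) (G (z k)))
    (hs : ∀ k, z (k + 1) - z k ≠ 0)
    (hA : ∀ k, A (k + 1) = bfgsUpdate (A k) (z (k + 1) - z k) (G (z (k + 1)) - G (z k)))
    (hc : 0 < c)
    (ε δ r : ℝ) (hε : 0 < ε) (hδ : 0 < δ) (hr0 : 0 < r) (hr1 : r < 1)
    (hc1 : ((2*δ + 1) * (4 * (1 + 2*ε^2 + ε^3) / (1 - ε)^2) + (3 + 2*ε) / (1 - ε)) * (ε / (1 - r)) ≤ δ)
    (hc2 : (2*δ + 1) * ε + 2*δ ≤ r)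
    (hz0 : c * ‖z 0‖ ≤ ε) (hA0 : frob (A 0 - 1) ≤ δ) {k : ℕ} (hk : 1 ≤ k) :
    ‖z k‖ ≤ ((2 * Real.sqrt 2 * δ * ((1 + ε) * (1 + r) / ((1 - ε) * (1 - r))) * Real.sqrt (k:ℝ)
            + (1 + ε) * ε * (1 + r) / ((1 - ε)^2 * (1 - r)^2)) / (k:ℝ)) ^ k * ‖z 0‖ := by
  have hε1 : ε < 1 := by nlinarith
  have h1ε : 0 < 1 - ε := by linarith
  have h1r : 0 < 1 - r := by linarith
  set W := (2*δ + 1) * (4 * (1 + 2*ε^2 + ε^3) / (1 - ε)^2) + (3 + 2*ε) / (1 - ε) with hW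
  have hW0 : 0 ≤ W := by positivity
  set s : ℕ → E d := fun k => z (k + 1) - z k with hs_def
  set y : ℕ → E d := fun k => G (z (k + 1)) - G (z k) with hy_def
  set θ : ℕ → ℝ := fun k => ‖mApp (A k - 1) (y k)‖ / ‖y k‖ with hθ_def
  have hθ0 : ∀ k, 0 ≤ θ k := fun k => by positivity
  have hgeom : ∀ k, ∑ i ∈ Finset.range k, ε * r ^ i ≤ ε / (1 - r) :=
    sum_geometric_le hε.le hr0.le hr1
  have hGz : ∀ u, ‖G u - u‖ ≤ (c * ‖u‖) * ‖u‖ := fun u => by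
    simpa [hG0] using hG (c * ‖u‖) u 0 le_rfl (by simpa using by positivity)
  have hlin : ∀ k, c * ‖z k‖ ≤ ε → frob (A k - 1) ≤ 2 * δ → ‖z (k + 1)‖ ≤ r * ‖z k‖ := by
    intro k hσ hD
    have e1 : z (k + 1) = -(mApp (A k) (G (z k) - z k)) - mApp (A k - 1) (z k) := by
      rw [hz, mApp_sub, mApp_sub_left, mApp_one]; abel
    have e2 := norm_sub_le (-(mApp (A k) (G (z k) - z k))) (mApp (A k - 1) (z k))
    rw [← e1, norm_neg] at e2
    have e3 := norm_mApp_le_of_frob_sub_one hD (G (z k) - z k)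
    have e4 := norm_mApp_le (A k - 1) (z k)
    have e5 : ‖G (z k) - z k‖ ≤ ε * ‖z k‖ := (hGz _).trans (by gcongr)
    have e6 : (1 + 2 * δ) * ‖G (z k) - z k‖ ≤ (1 + 2 * δ) * (ε * ‖z k‖) := by gcongr
    have e7 : frob (A k - 1) * ‖z k‖ ≤ 2 * δ * ‖z k‖ := by gcongr
    have e8 := mul_le_mul_of_nonneg_right hc2 (norm_nonneg (z k))
    linarith
  have hrk : ∀ k, ε * r ^ k ≤ ε := fun k =>
    mul_le_of_le_one_right hε.le (pow_le_one₀ hr0.le hr1.le)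
  have hδr : 2 * δ ≤ r := by nlinarith
  have hys : ∀ k, c * ‖z k‖ ≤ ε * r ^ k → frob (A k - 1) ≤ 2 * δ →
      ‖y k - s k‖ ≤ ε * r ^ k * ‖s k‖ := by
    intro k hσ hD
    have h1 := hlin k (hσ.trans (hrk k)) hD
    refine hG _ _ _ (le_trans ?_ hσ) hσ
    gcongr
    exact h1.trans (mul_le_of_le_one_left (norm_nonneg _) hr1.le)
  have hind : ∀ k, c * ‖z k‖ ≤ ε * r ^ k ∧
      frob (A k - 1) + ∑ i ∈ Finset.range k, θ i ^ 2 / (2 * (2 * δ))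
        ≤ δ + W * ∑ i ∈ Finset.range k, ε * r ^ i := by
    intro k
    induction k with
    | zero => simpa using ⟨hz0, hA0⟩
    | succ k ih =>
      obtain ⟨hσ, hD⟩ := ih
      have hD2 : frob (A k - 1) ≤ 2 * δ := by
        have h1 : 0 ≤ ∑ i ∈ Finset.range k, θ i ^ 2 / (2 * (2 * δ)) :=
          Finset.sum_nonneg fun i _ => by positivity
        nlinarith [mul_le_mul_of_nonneg_left (hgeom k) hW0]
      constructor
      · have h1 := hlin k (hσ.trans (hrk k)) hD2
        have h2 := mul_le_mul_of_nonneg_left h1 hc.le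
        have h3 := mul_le_mul_of_nonneg_left hσ hr0.le
        rw [pow_succ]
        linarith
      · have h1 := frob_bfgsUpdate_sub_one_le (hs k) (by positivity) (hrk k) hε1
          (hys k hσ hD2) (by positivity) hD2
        rw [← hA k, ← hW] at h1
        rw [Finset.sum_range_succ, Finset.sum_range_succ, mul_add]
        linarith
  have hD : ∀ k, frob (A k - 1) + ∑ i ∈ Finset.range k, θ i ^ 2 / (2 * (2 * δ)) ≤ 2 * δ := by
    intro k
    linarith [(hind k).2, mul_le_mul_of_nonneg_left (hgeom k) hW0]
  have hD2 : ∀ k, frob (A k - 1) ≤ 2 * δ := by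
    intro k
    have h1 : 0 ≤ ∑ i ∈ Finset.range k, θ i ^ 2 / (2 * (2 * δ)) :=
      Finset.sum_nonneg fun i _ => by positivity
    linarith [hD k]
  have hθsq : ∑ i ∈ Finset.range k, θ i ^ 2 ≤ 8 * δ ^ 2 := by
    have h2 := hD k
    rw [← Finset.sum_div] at h2
    have h3 : (∑ i ∈ Finset.range k, θ i ^ 2) / (2 * (2 * δ)) ≤ 2 * δ := by
      linarith [frob_nonneg (A k - 1)]
    rw [div_le_iff₀ (by positivity)] at h3
    linarith
  have hstep : ∀ k, ‖z (k + 1)‖ ≤ (1 + ε) * (1 + r) / ((1 - ε) * (1 - r)) * (θ k + ε * r ^ k / (1 - ε)) * ‖z k‖ := by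
    intro k
    have hσ := (hind k).1
    refine norm_le_of_bfgs_step (hz k) (hs k) (by positivity) (hrk k) hε1 hr0 hr1
      (hys k hσ (hD2 k)) ((hD2 k).trans hδr) (hlin k (hσ.trans (hrk k)) (hD2 k))
      ((hGz _).trans ?_)
    gcongr
    exact (hind (k + 1)).1.trans (hrk _)
  exact le_pow_of_step_le (fun k => ‖z k‖) θ (fun _ => norm_nonneg _) hθ0 hε.le hε1 hδ.le hr0.le
    hr1 hθsq hstep hk

lemma mApp_inv_mApp {d : ℕ} {S : Mat d} (hS : S.PosDef) (v : E d) : mApp S⁻¹ (mApp S v) = v := by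
  rw [← mApp_mul, Matrix.nonsing_inv_mul _ hS.det_pos.ne'.isUnit, mApp_one]

lemma mApp_mApp_inv {d : ℕ} {S : Mat d} (hS : S.PosDef) (v : E d) : mApp S (mApp S⁻¹ v) = v := by
  rw [← mApp_mul, Matrix.mul_nonsing_inv _ hS.det_pos.ne'.isUnit, mApp_one]

lemma transpose_eq_of_posDef {d : ℕ} {S : Mat d} (hS : S.PosDef) : Sᵀ = S := by
  simpa [Matrix.conjTranspose_eq_transpose_of_trivial] using hS.isHermitian.eq

lemma norm_mApp_sq_of_posDef {d : ℕ} {S : Mat d} (hS : S.PosDef) (v : E d) :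
    ‖mApp S v‖ ^ 2 = dot v (mApp (S * S) v) := by
  rw [mApp_mul, dot_mApp, transpose_eq_of_posDef hS, dot_self]

/-- The BFGS update is covariant under a linear change of coordinates. -/
lemma mul_bfgsUpdate_mul {d : ℕ} {S : Mat d} (hS : S.PosDef) (H : Mat d) (s y : E d) :
    S * bfgsUpdate H s y * S = bfgsUpdate (S * H * S) (mApp S s) (mApp S⁻¹ y) := by
  have hST := transpose_eq_of_posDef hS
  have hSi : (S⁻¹)ᵀ = S⁻¹ := by rw [Matrix.transpose_nonsing_inv, hST]
  have hu := hS.det_pos.ne'.isUnit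
  have hdot : dot (mApp S⁻¹ y) (mApp S s) = dot y s := by
    rw [dot_mApp, hST, mApp_mApp_inv hS]
  have h1 : S * (1 - (dot y s)⁻¹ • outer s y)
      = (1 - (dot y s)⁻¹ • outer (mApp S s) (mApp S⁻¹ y)) * S := by
    rw [mul_sub, sub_mul, Matrix.mul_smul, Matrix.smul_mul, mul_outer, outer_mul, hST,
      mApp_mApp_inv hS, mul_one, one_mul]
  have h2 : (1 - (dot y s)⁻¹ • outer y s) * S
      = S * (1 - (dot y s)⁻¹ • outer (mApp S⁻¹ y) (mApp S s)) := by
    rw [mul_sub, sub_mul, Matrix.mul_smul, Matrix.smul_mul, mul_outer, outer_mul, hST,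
      mApp_mApp_inv hS, mul_one, one_mul]
  have h3 : S * outer s s * S = outer (mApp S s) (mApp S s) := by
    rw [mul_outer, outer_mul, hST]
  rw [bfgsUpdate, bfgsUpdate, dot_comm (mApp S s), hdot, dot_comm s y, mul_add, add_mul,
    Matrix.mul_smul, Matrix.smul_mul, h3, ← mul_assoc, ← mul_assoc, h1, mul_assoc _ _ S, h2]
  simp only [mul_assoc]

theorem bfgs_superlinear_convergence
    {d : ℕ}
    (f : E d → ℝ) (g : E d → E d) (Hess : E d → Mat d) (xs : E d)
    (μ L M : ℝ) (hμ : 0 < μ) (hμL : μ ≤ L) (hM : 0 < M)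
    -- `g` is the gradient of `f`, and `Hess` its Hessian (so `f` is twice differentiable)
    (hg : ∀ x, HasGradientAt f (g x) x)
    (hHd : ∀ x, HasFDerivAt g (Matrix.toEuclideanCLM (𝕜 := ℝ) (Hess x)) x)
    -- `xs` is the unique minimizer of `f`
    (hmin : ∀ x, f xs ≤ f x)
    (huniq : ∀ x, (∀ y, f x ≤ f y) → x = xs)
    -- Assumption 1: strong convexity and gradient Lipschitz continuity
    (hgl : ∀ x y, μ * ‖x - y‖ ≤ ‖g x - g y‖)
    (hgu : ∀ x y, ‖g x - g y‖ ≤ L * ‖x - y‖)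
    (hHl : ∀ x v, μ * ‖v‖ ^ 2 ≤ dot v (mApp (Hess x) v))
    (hHu : ∀ x v, dot v (mApp (Hess x) v) ≤ L * ‖v‖ ^ 2)
    -- Assumption 2: Hessian Lipschitz continuity toward the optimum
    (hLip : ∀ x, spec (Hess x - Hess xs) ≤ M * ‖x - xs‖)
    -- `sqH` is the positive definite square root `H_*^{1/2}` of `H_* = ∇²f(x_*)`
    (sqH : Mat d) (hsqH : sqH.PosDef) (hsqH2 : sqH * sqH = Hess xs)
    -- the BFGS method
    (x : ℕ → E d) (H : ℕ → Mat d)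
    (hH0pd : (H 0).PosDef)
    (hxup : ∀ k, x (k+1) = x k - mApp (H k) (g (x k)))
    (hsne : ∀ k, x (k+1) - x k ≠ 0)
    (hHup : ∀ k, H (k+1) = bfgsUpdate (H k) (x (k+1) - x k) (g (x (k+1)) - g (x k)))
    (ε δ r : ℝ) (hε : 0 < ε) (hδ : 0 < δ) (hr0 : 0 < r) (hr1 : r < 1)
    (hc1 : ((2*δ + 1) * (4 * (1 + 2*ε^2 + ε^3) / (1 - ε)^2) + (3 + 2*ε) / (1 - ε)) * (ε / (1 - r)) ≤ δ)
    (hc2 : (2*δ + 1) * ε + 2*δ ≤ r)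
    (hx0 : ‖x 0 - xs‖ ≤ μ ^ ((3:ℝ)/2) / (M * Real.sqrt L) * ε)
    (hH0 : frob (sqH * H 0 * sqH - 1) ≤ δ) :
    ∀ k : ℕ, 1 ≤ k →
      ‖x k - xs‖ ≤ Real.sqrt (L / μ) *
        ((2 * Real.sqrt 2 * δ * ((1 + ε) * (1 + r) / ((1 - ε) * (1 - r))) * Real.sqrt (k:ℝ)
            + (1 + ε) * ε * (1 + r) / ((1 - ε)^2 * (1 - r)^2)) / (k:ℝ)) ^ k * ‖x 0 - xs‖ := by
  intro k hk
  have hL : 0 < L := hμ.trans_le hμL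
  have hu := hsqH.det_pos.ne'.isUnit
  have hgs : g xs = 0 := by
    have h1 : IsLocalMin f xs := Filter.Eventually.of_forall hmin
    exact (map_eq_zero_iff _ (InnerProductSpace.toDual ℝ (E d)).injective).1
      (h1.hasFDerivAt_eq_zero (hg xs).hasFDerivAt)
  have hlow : ∀ v, √μ * ‖v‖ ≤ ‖mApp sqH v‖ := fun v => by
    refine le_of_sq_le_sq ?_ (norm_nonneg _)
    rw [mul_pow, Real.sq_sqrt hμ.le, norm_mApp_sq_of_posDef hsqH, hsqH2]
    exact hHl xs v
  have hupp : ∀ v, ‖mApp sqH v‖ ≤ √L * ‖v‖ := fun v => by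
    refine le_of_sq_le_sq ?_ (by positivity)
    rw [mul_pow, Real.sq_sqrt hL.le, norm_mApp_sq_of_posDef hsqH, hsqH2]
    exact hHu xs v
  have hsμ : 0 < √μ := Real.sqrt_pos.2 hμ
  have hsL : 0 < √L := Real.sqrt_pos.2 hL
  have hinv : ∀ v, ‖mApp sqH⁻¹ v‖ ≤ (√μ)⁻¹ * ‖v‖ := fun v => by
    have := hlow (mApp sqH⁻¹ v)
    rw [mApp_mApp_inv hsqH] at this
    rw [inv_mul_eq_div, le_div_iff₀ hsμ]
    linarith
  have hμ32 : μ ^ ((3 : ℝ) / 2) = √μ * √μ * √μ := by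
    rw [Real.mul_self_sqrt hμ.le, Real.sqrt_eq_rpow, ← Real.rpow_one_add' hμ.le (by norm_num)]
    norm_num
  set G : E d → E d := fun u => mApp sqH⁻¹ (g (xs + mApp sqH⁻¹ u)) with hGdef
  set z : ℕ → E d := fun k => mApp sqH (x k - xs) with hzdef
  have hGz : ∀ k, G (z k) = mApp sqH⁻¹ (g (x k)) := fun k => by
    simp only [hGdef, hzdef, mApp_inv_mApp hsqH, add_sub_cancel]
  have hzs : ∀ k, z (k + 1) - z k = mApp sqH (x (k + 1) - x k) := fun k => by
    simp only [hzdef, ← mApp_sub, sub_sub_sub_cancel_right]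
  set c := M / μ ^ ((3 : ℝ) / 2) with hcdef
  have hc : 0 < c := by positivity
  have hder : ∀ u, HasFDerivAt (fun u => G u - u)
      (Matrix.toEuclideanCLM (𝕜 := ℝ) (sqH⁻¹ * (Hess (xs + mApp sqH⁻¹ u) - Hess xs) * sqH⁻¹)) u := by
    intro u
    have h1 : HasFDerivAt (fun u => xs + mApp sqH⁻¹ u) (Matrix.toEuclideanCLM (𝕜 := ℝ) sqH⁻¹) u :=
      (Matrix.toEuclideanCLM (𝕜 := ℝ) sqH⁻¹).hasFDerivAt.const_add xs
    have h2 := ((Matrix.toEuclideanCLM (𝕜 := ℝ) sqH⁻¹).hasFDerivAt.comp u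
      ((hHd (xs + mApp sqH⁻¹ u)).comp u h1)).sub (hasFDerivAt_id u)
    convert! h2 using 1
    have h3 : sqH⁻¹ * Hess xs * sqH⁻¹ = 1 := by
      rw [← hsqH2, ← mul_assoc, Matrix.nonsing_inv_mul _ hu, one_mul,
        Matrix.mul_nonsing_inv _ hu]
    rw [mul_sub, sub_mul, h3, map_sub, map_mul, map_mul, map_one, mul_assoc]
    rfl
  have hbound : ∀ u, ‖Matrix.toEuclideanCLM (𝕜 := ℝ)
      (sqH⁻¹ * (Hess (xs + mApp sqH⁻¹ u) - Hess xs) * sqH⁻¹)‖ ≤ c * ‖u‖ := by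
    intro u
    refine ContinuousLinearMap.opNorm_le_bound _ (by positivity) fun v => ?_
    change ‖mApp _ v‖ ≤ _
    rw [mApp_mul, mApp_mul]
    have h1 := hLip (xs + mApp sqH⁻¹ u)
    rw [add_sub_cancel_left] at h1
    calc ‖mApp sqH⁻¹ (mApp (Hess (xs + mApp sqH⁻¹ u) - Hess xs) (mApp sqH⁻¹ v))‖
        ≤ (√μ)⁻¹ * ‖mApp (Hess (xs + mApp sqH⁻¹ u) - Hess xs) (mApp sqH⁻¹ v)‖ := hinv _
      _ ≤ (√μ)⁻¹ * (spec (Hess (xs + mApp sqH⁻¹ u) - Hess xs) * ‖mApp sqH⁻¹ v‖) := by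
          gcongr
          exact ContinuousLinearMap.le_opNorm _ _
      _ ≤ (√μ)⁻¹ * (M * ((√μ)⁻¹ * ‖u‖) * ((√μ)⁻¹ * ‖v‖)) := by
          gcongr
          · exact h1.trans (by gcongr; exact hinv u)
          · exact hinv v
      _ = c * ‖u‖ * ‖v‖ := by
          rw [hcdef, hμ32]
          field_simp
  have hG : ∀ τ u v, c * ‖u‖ ≤ τ → c * ‖v‖ ≤ τ → ‖G u - G v - (u - v)‖ ≤ τ * ‖u - v‖ := by
    intro τ u v hu hv
    have hmem : ∀ w : E d, c * ‖w‖ ≤ τ ↔ w ∈ Metric.closedBall (0 : E d) (τ / c) := fun w => by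
      rw [mem_closedBall_zero_iff, le_div_iff₀ hc, mul_comm]
    have h := (convex_closedBall (0 : E d) (τ / c)).norm_image_sub_le_of_norm_hasFDerivWithin_le
      (fun w _ => (hder w).hasFDerivWithinAt)
      (fun w hw => (hbound w).trans ((hmem w).2 hw)) ((hmem v).1 hv) ((hmem u).1 hu)
    rwa [sub_sub_sub_comm] at h
  have hz0 : c * ‖z 0‖ ≤ ε := by
    have h1 : ‖z 0‖ ≤ √L * (μ ^ ((3:ℝ)/2) / (M * √L) * ε) :=
      (hupp _).trans (by gcongr)
    calc c * ‖z 0‖ ≤ c * (√L * (μ ^ ((3:ℝ)/2) / (M * √L) * ε)) := by gcongr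
      _ = ε := by
        have : 0 < μ ^ ((3:ℝ)/2) := by positivity
        rw [hcdef]
        field_simp
  have hmain := bfgs_scaled G z (fun k => sqH * H k * sqH) c
    (by simp [hGdef, mApp, hgs]) hG
    (fun k => by
      rw [hGz, mApp_mul, mApp_mApp_inv hsqH, mApp_mul, ← mApp_sub]
      rw [hzdef]
      simp only [hxup k]
      congr 1
      abel)
    (fun k h => hsne k (by
      have := congrArg (mApp sqH⁻¹) (hzs k ▸ h)
      rwa [mApp_inv_mApp hsqH, mApp, map_zero] at this))
    (fun k => by
      rw [hHup k, mul_bfgsUpdate_mul hsqH, hzs, hGz, hGz, mApp_sub sqH⁻¹])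
    hc ε δ r hε hδ hr0 hr1 hc1 hc2 hz0 hH0 hk
  have hε1 : ε < 1 := by nlinarith
  have h1ε : 0 < 1 - ε := by linarith
  have h1r : 0 < 1 - r := by linarith
  have hxk : ‖x k - xs‖ ≤ (√μ)⁻¹ * ‖z k‖ := by
    rw [inv_mul_eq_div, le_div_iff₀ hsμ]
    linarith [hlow (x k - xs)]
  rw [Real.sqrt_div hL.le]
  set R := ((2 * √2 * δ * ((1 + ε) * (1 + r) / ((1 - ε) * (1 - r))) * √(k : ℝ)
            + (1 + ε) * ε * (1 + r) / ((1 - ε)^2 * (1 - r)^2)) / (k:ℝ)) ^ k with hR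
  have hR0 : 0 ≤ R := by positivity
  calc ‖x k - xs‖ ≤ (√μ)⁻¹ * (R * (√L * ‖x 0 - xs‖)) := by
        refine hxk.trans ?_
        gcongr
        exact hmain.trans (by gcongr; exact hupp _)
    _ = √L / √μ * R * ‖x 0 - xs‖ := by ring
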